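/- arXiv:1309.5597 — 4 statements merged into one kernel-verified Lean document; each statement's English description precedes it below -/
import Mathlib

section
/- Let p be a prime number with p ≡ 2 (mod 9) or p ≡ 5 (mod 9). Then there exists a set S of monic irreducible polynomials in 𝔽_p[x] such that S is an F-set, S is infinite, and S is not equal to the set of all monic irreducible polynomials in 𝔽_p[x]. -/
open Polynomial

theorem two_mul_three_pow_dvd_of_three_pow_succ_dvd {p k m : ℕ}
    (hmod : p % 9 = 2 ∨ p % 9 = 5) (h : 3 ^ (k + 1) ∣ p ^ m - 1) : 2 * 3 ^ k ∣ m := by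
  have hp1 : 1 ≤ p := by omega
  have hmod3 : p ^ m ≡ 1 [MOD 3] :=
    ((Nat.modEq_iff_dvd' (Nat.one_le_pow _ _ hp1)).2
      ((dvd_pow_self 3 k.succ_ne_zero).trans h)).symm
  have hp3 : p ≡ 2 [MOD 3] := by unfold Nat.ModEq; omega
  obtain ⟨n, rfl⟩ : 2 ∣ m := by
    by_contra hm
    obtain ⟨n, rfl⟩ : Odd m := by rwa [← Nat.not_even_iff_odd, even_iff_two_dvd]
    have h2 : p ^ 2 ≡ 1 [MOD 3] := (hp3.pow 2).trans (by decide)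
    have h3 : p ^ (2 * n + 1) ≡ 2 [MOD 3] := by
      rw [pow_succ, pow_mul]
      simpa using (h2.pow n).mul hp3
    exact absurd (hmod3.symm.trans h3) (by decide)
  have hsq : p ^ 2 % 9 = 4 ∨ p ^ 2 % 9 = 7 := by
    rcases hmod with h | h <;> simp [Nat.pow_mod, h]
  have hmul : emultiplicity 3 (p ^ 2 - 1) = 1 := by
    have : emultiplicity 3 (p ^ 2 - 1) = ((1 : ℕ) : ℕ∞) :=
      emultiplicity_eq_coe.2 ⟨by omega, by omega⟩
    simpa using this
  have hlte := Nat.emultiplicity_pow_sub_pow Nat.prime_three (by decide) (x := p ^ 2) (y := 1)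
    (by omega) (by omega) n
  rw [one_pow, hmul, ← pow_mul] at hlte
  have hle := le_emultiplicity_of_pow_dvd h
  rw [hlte, Nat.cast_add, Nat.cast_one, add_comm, ENat.add_le_add_iff_left (by simp)] at hle
  exact Nat.mul_dvd_mul_left 2 (pow_dvd_of_le_emultiplicity hle)

theorem orderOf_unitOfCoprime_three_pow_succ {p k : ℕ} (hmod : p % 9 = 2 ∨ p % 9 = 5)
    (hc : p.Coprime (3 ^ (k + 1))) : orderOf (ZMod.unitOfCoprime p hc) = 2 * 3 ^ k := by
  apply dvd_antisymm
  · have h := orderOf_dvd_card (x := ZMod.unitOfCoprime p hc)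
    rwa [ZMod.card_units_eq_totient, Nat.totient_prime_pow_succ Nat.prime_three,
      mul_comm] at h
  · apply two_mul_three_pow_dvd_of_three_pow_succ_dvd hmod
    have h := congrArg Units.val (pow_orderOf_eq_one (ZMod.unitOfCoprime p hc))
    rw [Units.val_pow_eq_pow_val, ZMod.coe_unitOfCoprime, Units.val_one, ← Nat.cast_pow] at h
    have hmodEq := (ZMod.natCast_eq_natCast_iff _ 1 _).1 (h.trans Nat.cast_one.symm)
    exact (Nat.modEq_iff_dvd' (Nat.one_le_pow _ _ (by omega))).1 hmodEq.symm

/-- The trinomial `X ^ (2 * 3 ^ k) + ε * X ^ 3 ^ k + 1`, of interest for `ε = ±1`. -/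
noncomputable def cyclotomicTrinomial {R : Type*} [CommRing R] (ε : R) (k : ℕ) : R[X] :=
  X ^ (2 * 3 ^ k) + C ε * X ^ 3 ^ k + 1

namespace cyclotomicTrinomial

section CommRing

variable {R : Type*} [CommRing R]

theorem one_eq_cyclotomic (k : ℕ) :
    cyclotomicTrinomial (1 : R) k = cyclotomic (3 ^ (k + 1)) R := by
  rw [cyclotomic_prime_pow_eq_geom_sum Nat.prime_three, cyclotomicTrinomial]
  simp only [Finset.sum_range_succ, Finset.sum_range_zero, C_1]
  ring

theorem neg_one_eq_comp (k : ℕ) :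
    cyclotomicTrinomial (-1 : R) k = (cyclotomicTrinomial (1 : R) k).comp (-X) := by
  have h : Odd (3 ^ k) := Odd.pow (by decide)
  simp [cyclotomicTrinomial, pow_mul, h.neg_pow]

theorem natDegree_eq [Nontrivial R] (ε : R) (k : ℕ) :
    (cyclotomicTrinomial ε k).natDegree = 2 * 3 ^ k := by
  have h : 0 < 3 ^ k := by positivity
  unfold cyclotomicTrinomial
  compute_degree!

theorem monic (ε : R) (k : ℕ) : (cyclotomicTrinomial ε k).Monic := by
  have h : 0 < 3 ^ k := by positivity
  nontriviality R
  rw [Monic, leadingCoeff, natDegree_eq, cyclotomicTrinomial, coeff_add, coeff_add,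
    coeff_X_pow_self, coeff_C_mul, coeff_X_pow, coeff_one]
  rw [if_neg (by omega), if_neg (by omega)]
  simp

theorem sub_C_coeff_zero (ε : R) (k : ℕ) :
    cyclotomicTrinomial ε k - C ((cyclotomicTrinomial ε k).coeff 0)
      = X ^ 3 ^ k * (X ^ 3 ^ k - C (-ε)) := by
  have h : (cyclotomicTrinomial ε k).coeff 0 = 1 := by
    simp [cyclotomicTrinomial, coeff_zero_eq_eval_zero]
  rw [h, cyclotomicTrinomial, C_1, C_neg]
  ring

theorem X_pow_succ_sub_C {ε : R} (hε : ε ^ 2 = 1) (k : ℕ) :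
    X ^ 3 ^ (k + 1) - C ε = (X ^ 3 ^ k - C ε) * cyclotomicTrinomial ε k := by
  have h : (C ε : R[X]) ^ 2 = 1 := by rw [← C_pow, hε, C_1]
  rw [cyclotomicTrinomial]
  linear_combination (X : R[X]) ^ 3 ^ k * h

end CommRing

theorem irreducible {p : ℕ} [hp : Fact p.Prime] (hmod : p % 9 = 2 ∨ p % 9 = 5)
    {ε : ZMod p} (hε : ε = 1 ∨ ε = -1) (k : ℕ) : Irreducible (cyclotomicTrinomial ε k) := by
  have hone : Irreducible (cyclotomicTrinomial (1 : ZMod p) k) := by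
    have hpn : ¬ p ∣ 3 ^ (k + 1) := fun h ↦ by
      have := (Nat.prime_dvd_prime_iff_eq hp.out Nat.prime_three).1 (hp.out.dvd_of_dvd_pow h)
      omega
    refine ZMod.irreducible_of_dvd_cyclotomic_of_natDegree hpn (one_eq_cyclotomic k).dvd ?_
    rw [natDegree_eq, orderOf_unitOfCoprime_three_pow_succ hmod]
  rcases hε with rfl | rfl
  · exact hone
  · rw [neg_one_eq_comp, comp_eq_aeval]
    exact (MulEquiv.irreducible_iff (algEquivAevalNegX (R := ZMod p))).2 hone

theorem eq_of_dvd_X_pow_sub_C {p : ℕ} [Fact p.Prime] (hmod : p % 9 = 2 ∨ p % 9 = 5)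
    {ε : ZMod p} (hε : ε = 1 ∨ ε = -1) {Q : (ZMod p)[X]} (hQm : Q.Monic) (hQ : Irreducible Q)
    {k : ℕ} (h : Q ∣ X ^ 3 ^ k - C ε) : Q = X - C ε ∨ ∃ j, Q = cyclotomicTrinomial ε j := by
  induction k with
  | zero =>
    rw [pow_zero, pow_one] at h
    exact .inl <| eq_of_monic_of_associated hQm (monic_X_sub_C ε) <|
      hQ.associated_of_dvd (irreducible_X_sub_C ε) h
  | succ k ih =>
    rw [X_pow_succ_sub_C (by rcases hε with rfl | rfl <;> simp)] at h
    rcases hQ.prime.dvd_or_dvd h with h | h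
    · exact ih h
    · exact .inr ⟨k, eq_of_monic_of_associated hQm (monic ε k) <|
        hQ.associated_of_dvd (irreducible hmod hε k) h⟩

end cyclotomicTrinomial

theorem ZMod.exists_monic_irreducible_natDegree_eq (p : ℕ) [Fact p.Prime] {n : ℕ} (hn : n ≠ 0) :
    ∃ P : (ZMod p)[X], P.Monic ∧ Irreducible P ∧ P.natDegree = n := by
  obtain ⟨α, hα⟩ := Field.exists_primitive_element (ZMod p) (GaloisField p n)
  have hint : IsIntegral (ZMod p) α := .of_finite _ α
  refine ⟨minpoly (ZMod p) α, minpoly.monic hint, minpoly.irreducible hint, ?_⟩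
  rw [(Field.primitive_element_iff_minpoly_natDegree_eq _ α).1 hα, GaloisField.finrank p hn]

theorem stmt_0 (p : ℕ) (hp : p.Prime) (hmod : p % 9 = 2 ∨ p % 9 = 5) :
    ∃ S : Set (Polynomial (ZMod p)),
      (∀ P ∈ S, P.Monic ∧ Irreducible P) ∧
      (∀ P ∈ S, ∀ Q : Polynomial (ZMod p), Q.Monic → Irreducible Q →
        Q ∣ (P - C (P.coeff 0)) → Q ∈ S) ∧
      S.Infinite ∧
      S ≠ {P : Polynomial (ZMod p) | P.Monic ∧ Irreducible P} := by
  have : Fact p.Prime := ⟨hp⟩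
  have eq_X {Q : (ZMod p)[X]} (hQm : Q.Monic) (hQ : Irreducible Q) (h : Q ∣ X) : Q = X :=
    eq_of_monic_of_associated hQm monic_X (hQ.associated_of_dvd irreducible_X h)
  refine ⟨{P | P = X ∨ ∃ ε : ZMod p, (ε = 1 ∨ ε = -1) ∧
    (P = X - C ε ∨ ∃ k, P = cyclotomicTrinomial ε k)}, ?_, ?_, ?_, ?_⟩
  · rintro P (rfl | ⟨ε, hε, rfl | ⟨k, rfl⟩⟩)
    · exact ⟨monic_X, irreducible_X⟩
    · exact ⟨monic_X_sub_C ε, irreducible_X_sub_C ε⟩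
    · exact ⟨cyclotomicTrinomial.monic ε k, cyclotomicTrinomial.irreducible hmod hε k⟩
  · rintro P (rfl | ⟨ε, hε, rfl | ⟨k, rfl⟩⟩) Q hQm hQ h
    · exact .inl (eq_X hQm hQ (by simpa using h))
    · exact .inl (eq_X hQm hQ (by simpa using h))
    · rw [cyclotomicTrinomial.sub_C_coeff_zero] at h
      rcases hQ.prime.dvd_or_dvd h with h | h
      · exact .inl (eq_X hQm hQ (hQ.prime.dvd_of_dvd_pow h))
      · have hε' : -ε = 1 ∨ -ε = -1 := by rcases hε with rfl | rfl <;> simp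
        exact .inr ⟨-ε, hε', cyclotomicTrinomial.eq_of_dvd_X_pow_sub_C hmod hε' hQm hQ h⟩
  · refine Set.infinite_of_injective_forall_mem (f := cyclotomicTrinomial (1 : ZMod p)) ?_
      fun k ↦ .inr ⟨1, .inl rfl, .inr ⟨k, rfl⟩⟩
    intro i j hij
    have h := congrArg natDegree hij
    rw [cyclotomicTrinomial.natDegree_eq, cyclotomicTrinomial.natDegree_eq] at h
    exact Nat.pow_right_injective (by decide : 2 ≤ 3) (Nat.eq_of_mul_eq_mul_left two_pos h)
  · intro hS
    obtain ⟨P, hPm, hP, hdeg⟩ := ZMod.exists_monic_irreducible_natDegree_eq p four_ne_zero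
    have hmem : P ∈ {P : (ZMod p)[X] | P.Monic ∧ Irreducible P} := ⟨hPm, hP⟩
    rw [← hS] at hmem
    rcases hmem with rfl | ⟨ε, hε, rfl | ⟨k, rfl⟩⟩
    · simp at hdeg
    · simp at hdeg
    · rw [cyclotomicTrinomial.natDegree_eq] at hdeg
      have h : Odd (3 ^ k) := Odd.pow (by decide)
      obtain ⟨m, hm⟩ := h
      omega
end

section
/- Let p be a prime number with p ≡ 2 (mod 9) or p ≡ 5 (mod 9). Then for every natural number ℓ, the polynomial f_ℓ(x) = x^(2·3^ℓ) + x^(3^ℓ) + 1 is a monic irreducible polynomial in 𝔽_p[x]. -/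
open Polynomial

theorem orderOf_natCast_zmod_three_pow {p : ℕ} (hmod : p % 9 = 2 ∨ p % 9 = 5) (n : ℕ) :
    orderOf (p : ZMod (3 ^ (n + 1))) = 2 * 3 ^ n := by
  have hsq : orderOf ((p : ZMod (3 ^ (n + 1))) ^ 2) = 3 ^ n := by
    obtain ⟨a, ha, ha3⟩ : ∃ a : ℕ, p ^ 2 = 1 + 3 * a ∧ ¬ 3 ∣ a := by
      obtain ⟨k, hk⟩ : ∃ k, p = 9 * k + 2 ∨ p = 9 * k + 5 := ⟨p / 9, by omega⟩
      rcases hk with rfl | rfl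
      · exact ⟨27 * k ^ 2 + 12 * k + 1, by ring, by omega⟩
      · exact ⟨27 * k ^ 2 + 30 * k + 8, by ring, by omega⟩
    have h := ZMod.orderOf_one_add_mul_prime Nat.prime_three (by norm_num) (a : ℤ)
      (by exact_mod_cast ha3) n
    rw [← h, ← Nat.cast_pow, ha]
    push_cast
    rfl
  have heven : 2 ∣ orderOf (p : ZMod (3 ^ (n + 1))) := by
    have h2 : orderOf (p : ZMod 3) = 2 := by
      have hp3 : (p : ZMod 3) = 2 :=
        (ZMod.natCast_eq_natCast_iff' p 2 3).mpr (by omega)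
      rw [hp3]
      exact orderOf_eq_prime (by decide) (by decide)
    rw [← h2]
    simpa using orderOf_map_dvd
      (ZMod.castHom (dvd_pow_self 3 n.succ_ne_zero) (ZMod 3)).toMonoidHom
      (p : ZMod (3 ^ (n + 1)))
  rw [orderOf_pow' _ two_ne_zero, Nat.gcd_eq_right heven] at hsq
  omega

theorem stmt_1 (p : ℕ) (hp : p.Prime) (hmod : p % 9 = 2 ∨ p % 9 = 5) (ℓ : ℕ) :
    ((X : Polynomial (ZMod p)) ^ (2 * 3 ^ ℓ) + X ^ (3 ^ ℓ) + 1).Monic ∧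
    Irreducible ((X : Polynomial (ZMod p)) ^ (2 * 3 ^ ℓ) + X ^ (3 ^ ℓ) + 1) := by
  have : Fact p.Prime := ⟨hp⟩
  have hcyc : (X : Polynomial (ZMod p)) ^ (2 * 3 ^ ℓ) + X ^ (3 ^ ℓ) + 1 =
      cyclotomic (3 ^ (ℓ + 1)) (ZMod p) := by
    rw [cyclotomic_prime_pow_eq_geom_sum Nat.prime_three]
    simp only [Finset.sum_range_succ, Finset.sum_range_zero]
    ring
  rw [hcyc]
  refine ⟨cyclotomic.monic _ _, ?_⟩
  have hdvd : ¬ p ∣ 3 ^ (ℓ + 1) := by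
    intro h
    have := (Nat.prime_dvd_prime_iff_eq hp Nat.prime_three).mp (hp.dvd_of_dvd_pow h)
    omega
  refine ZMod.irreducible_of_dvd_cyclotomic_of_natDegree hdvd dvd_rfl ?_
  rw [natDegree_cyclotomic, Nat.totient_prime_pow_succ Nat.prime_three, ← orderOf_units,
    ZMod.coe_unitOfCoprime, orderOf_natCast_zmod_three_pow hmod, mul_comm]
end

section
/- Let p be a prime number with p ≡ 2 (mod 9) or p ≡ 5 (mod 9). Then for every natural number ℓ, the polynomial g_ℓ(x) = x^(2·3^ℓ) − x^(3^ℓ) + 1 is a monic irreducible polynomial in 𝔽_p[x]. -/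
open Polynomial

lemma exists_pow_two_mul_three_pow_eq {a : ℕ} (ha : a % 9 = 2 ∨ a % 9 = 5) (k : ℕ) :
    ∃ c : ℕ, a ^ (2 * 3 ^ k) = c * 3 ^ (k + 1) + 1 ∧ ¬ 3 ∣ c := by
  induction k with
  | zero =>
    have h : a ^ 2 % 9 = 4 ∨ a ^ 2 % 9 = 7 := by
      rcases ha with h | h <;> simp [Nat.pow_mod, h]
    exact ⟨a ^ 2 / 3, by simp only [pow_zero, mul_one, zero_add, pow_one]; omega, by omega⟩
  | succ k ih =>
    obtain ⟨c, hc, h3⟩ := ih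
    refine ⟨c + 3 * (c ^ 2 * 3 ^ k + c ^ 3 * (3 ^ k) ^ 2), ?_, by omega⟩
    rw [pow_succ 3 k, ← mul_assoc, pow_mul, hc]
    ring

lemma orderOf_unitOfCoprime_three_pow {a : ℕ} (ha : a % 9 = 2 ∨ a % 9 = 5) (ℓ : ℕ)
    (hcop : a.Coprime (3 ^ (ℓ + 1))) :
    orderOf (ZMod.unitOfCoprime a hcop) = 2 * 3 ^ ℓ := by
  have hpow (m : ℕ) : ZMod.unitOfCoprime a hcop ^ m = 1 ↔ a ^ m ≡ 1 [MOD 3 ^ (ℓ + 1)] := by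
    rw [← ZMod.natCast_eq_natCast_iff, Units.ext_iff]
    simp
  refine orderOf_eq_of_pow_and_pow_div_prime (by positivity) ?_ fun q hq hdvd h ↦ ?_
  · obtain ⟨c, hc, -⟩ := exists_pow_two_mul_three_pow_eq ha ℓ
    rw [hpow, hc]
    simp [Nat.ModEq]
  rw [hpow] at h
  rcases hq.dvd_mul.mp hdvd with h2 | h3
  · rw [(Nat.prime_dvd_prime_iff_eq hq Nat.prime_two).mp h2,
      Nat.mul_div_cancel_left _ two_pos] at h
    have hmod : a ^ 3 ^ ℓ ≡ 1 [MOD 3] := h.of_dvd (dvd_pow_self 3 ℓ.succ_ne_zero)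
    obtain ⟨j, hj⟩ : Odd (3 ^ ℓ) := Odd.pow (by decide)
    have ha3 : a % 3 = 2 := by omega
    rw [hj, pow_succ, pow_mul, Nat.ModEq, Nat.mul_mod, Nat.pow_mod, Nat.pow_mod a, ha3] at hmod
    simp at hmod
  · obtain rfl := (Nat.prime_dvd_prime_iff_eq hq Nat.prime_three).mp (hq.dvd_of_dvd_pow h3)
    cases ℓ with
    | zero => simp at h3
    | succ k =>
      obtain ⟨c, hc, hc3⟩ := exists_pow_two_mul_three_pow_eq ha k
      rw [pow_succ 3 k, ← mul_assoc, Nat.mul_div_cancel _ three_pos, hc] at h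
      have hd := (Nat.modEq_iff_dvd' (Nat.le_add_left 1 _)).mp h.symm
      rw [Nat.add_sub_cancel, pow_succ', Nat.mul_dvd_mul_iff_right (by positivity)] at hd
      exact hc3 hd

lemma irreducible_cyclotomic_three_pow {p : ℕ} (hp : p.Prime) (hmod : p % 9 = 2 ∨ p % 9 = 5)
    (ℓ : ℕ) : Irreducible (cyclotomic (3 ^ (ℓ + 1)) (ZMod p)) := by
  have : Fact p.Prime := ⟨hp⟩
  have hpn : ¬ p ∣ 3 ^ (ℓ + 1) := fun h ↦ by
    have := (Nat.prime_dvd_prime_iff_eq hp Nat.prime_three).mp (hp.dvd_of_dvd_pow h)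
    omega
  refine ZMod.irreducible_of_dvd_cyclotomic_of_natDegree hpn dvd_rfl ?_
  rw [orderOf_unitOfCoprime_three_pow hmod, natDegree_cyclotomic,
    Nat.totient_prime_pow_succ Nat.prime_three, mul_comm]

theorem stmt_2 (p : ℕ) (hp : p.Prime) (hmod : p % 9 = 2 ∨ p % 9 = 5) (ℓ : ℕ) :
    ((X : Polynomial (ZMod p)) ^ (2 * 3 ^ ℓ) - X ^ (3 ^ ℓ) + 1).Monic ∧
    Irreducible ((X : Polynomial (ZMod p)) ^ (2 * 3 ^ ℓ) - X ^ (3 ^ ℓ) + 1) := by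
  have : Fact p.Prime := ⟨hp⟩
  constructor
  · have h : 0 < 3 ^ ℓ := by positivity
    monicity <;> omega
  · have h := (MulEquiv.irreducible_iff (algEquivAevalNegX (R := ZMod p))).mpr
      (irreducible_cyclotomic_three_pow hp hmod ℓ)
    convert h using 1
    rw [cyclotomic_prime_pow_eq_geom_sum Nat.prime_three]
    have hodd : Odd (3 ^ ℓ) := Odd.pow (by decide)
    simp [Finset.sum_range_succ, algEquivAevalNegX, hodd.neg_pow]
    ring
end

section
/- Let p be a prime number with p ≡ 2 (mod 9) or p ≡ 5 (mod 9). Then the set 𝓕 = {f_ℓ : ℓ ∈ ℕ} ∪ {g_ℓ : ℓ ∈ ℕ} ∪ {x − 1, x, x + 1} ⊆ 𝔽_p[x] is an F-set; that is, every element of 𝓕 is a monic irreducible polynomial, and for every P ∈ 𝓕 and every monic irreducible Q ∈ 𝔽_p[x] with Q dividing P − α_P (α_P the constant coefficient of P), one has Q ∈ 𝓕. -/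
open Polynomial

theorem Nat.two_mul_three_pow_dvd_of_three_pow_dvd_pow_sub_one {p d k : ℕ}
    (hmod : p % 9 = 2 ∨ p % 9 = 5) (h : 3 ^ (k + 1) ∣ p ^ d - 1) : 2 * 3 ^ k ∣ d := by
  have hp1 : 1 ≤ p ^ d := Nat.one_le_pow _ _ (by lia)
  have hp3 : p % 3 = 2 := by lia
  have h3 : p ^ d % 3 = 1 := by
    have := (dvd_pow_self 3 k.succ_ne_zero).trans h
    lia
  obtain ⟨e, rfl | rfl⟩ := d.even_or_odd'
  · rw [pow_mul] at h
    have hsq : p ^ 2 % 9 = 4 ∨ p ^ 2 % 9 = 7 := by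
      rcases hmod with h | h <;> simp [Nat.pow_mod, h]
    have hlte := Nat.emultiplicity_pow_sub_pow (p := 3) (x := p ^ 2) (y := 1)
      Nat.prime_three (by decide) (by lia) (by lia) e
    have hone : emultiplicity 3 (p ^ 2 - 1) = (1 : ℕ) :=
      emultiplicity_eq_coe.2 ⟨by lia, by lia⟩
    rw [one_pow, hone] at hlte
    rw [pow_dvd_iff_le_emultiplicity, hlte, add_comm, Nat.cast_add] at h
    refine Nat.mul_dvd_mul_left 2 (pow_dvd_of_le_emultiplicity ?_)
    exact (ENat.add_le_add_iff_left (by simp)).1 h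
  · rw [pow_succ, pow_mul, Nat.mul_mod, Nat.pow_mod, Nat.pow_mod p, hp3] at h3
    norm_num at h3

theorem Polynomial.cyclotomic_three_pow_succ (R : Type*) [CommRing R] (k : ℕ) :
    cyclotomic (3 ^ (k + 1)) R = X ^ (2 * 3 ^ k) + X ^ 3 ^ k + 1 := by
  rw [cyclotomic_prime_pow_eq_geom_sum Nat.prime_three]
  simp only [Finset.sum_range_succ, Finset.sum_range_zero]
  ring

theorem ZMod.irreducible_cyclotomic_three_pow_succ {p : ℕ} [hp : Fact p.Prime]
    (hmod : p % 9 = 2 ∨ p % 9 = 5) (k : ℕ) :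
    Irreducible (cyclotomic (3 ^ (k + 1)) (ZMod p)) := by
  have hpn : ¬ p ∣ 3 ^ (k + 1) := fun h ↦ by
    have := (Nat.prime_dvd_prime_iff_eq hp.out Nat.prime_three).1 (hp.out.dvd_of_dvd_pow h)
    lia
  refine ZMod.irreducible_of_dvd_cyclotomic_of_natDegree hpn dvd_rfl ?_
  have htot : (3 ^ (k + 1)).totient = 2 * 3 ^ k := by
    rw [Nat.totient_prime_pow_succ Nat.prime_three, mul_comm]
  set u := ZMod.unitOfCoprime p (hp.out.coprime_iff_not_dvd.2 hpn) with hu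
  rw [natDegree_cyclotomic, htot]
  refine Nat.dvd_antisymm ?_ (orderOf_dvd_of_pow_eq_one (htot ▸ ZMod.pow_totient u))
  refine Nat.two_mul_three_pow_dvd_of_three_pow_dvd_pow_sub_one hmod ?_
  have h := congrArg Units.val (pow_orderOf_eq_one u)
  rw [Units.val_pow_eq_pow_val, hu, ZMod.coe_unitOfCoprime, ← hu, Units.val_one] at h
  rw [← Nat.modEq_iff_dvd' (Nat.one_le_pow _ _ hp.out.pos), ← ZMod.natCast_eq_natCast_iff]
  simp [h]

section NegX

variable {R : Type*} [CommRing R]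

theorem Polynomial.comp_neg_X_trinomial (k : ℕ) :
    (X ^ (2 * 3 ^ k) + X ^ 3 ^ k + 1 : R[X]).comp (-X) = X ^ (2 * 3 ^ k) - X ^ 3 ^ k + 1 := by
  have h : Odd (3 ^ k) := Odd.pow (by decide)
  simp [pow_mul, h.neg_pow, sub_eq_add_neg]

theorem Irreducible.comp_neg_X [IsDomain R] {P : R[X]} (hP : Irreducible P) :
    Irreducible (P.comp (-X)) := by
  have := (MulEquiv.irreducible_iff (algEquivAevalNegX (R := R))).2 hP
  simpa [comp, aeval_def] using this

theorem Polynomial.X_pow_three_pow_sub_one (k : ℕ) :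
    (X ^ 3 ^ k - 1 : R[X]) =
      (X - 1) * ∏ i ∈ Finset.range k, (X ^ (2 * 3 ^ i) + X ^ 3 ^ i + 1) := by
  induction k with
  | zero => simp
  | succ k ih => rw [Finset.prod_range_succ, ← mul_assoc, ← ih]; ring

theorem Polynomial.X_pow_three_pow_add_one (k : ℕ) :
    (X ^ 3 ^ k + 1 : R[X]) =
      (X + 1) * ∏ i ∈ Finset.range k, (X ^ (2 * 3 ^ i) - X ^ 3 ^ i + 1) := by
  induction k with
  | zero => simp
  | succ k ih => rw [Finset.prod_range_succ, ← mul_assoc, ← ih]; ring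

end NegX

theorem stmt_10 (p : ℕ) (hp : p.Prime) (hmod : p % 9 = 2 ∨ p % 9 = 5) :
    let 𝓕 : Set (Polynomial (ZMod p)) :=
      {P | ∃ ℓ : ℕ, P = X ^ (2 * 3 ^ ℓ) + X ^ (3 ^ ℓ) + 1} ∪
      {P | ∃ ℓ : ℕ, P = X ^ (2 * 3 ^ ℓ) - X ^ (3 ^ ℓ) + 1} ∪
      {X - 1, X, X + 1}
    (∀ P ∈ 𝓕, P.Monic ∧ Irreducible P) ∧
    (∀ P ∈ 𝓕, ∀ Q : Polynomial (ZMod p), Q.Monic → Irreducible Q →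
      Q ∣ (P - C (P.coeff 0)) → Q ∈ 𝓕) := by
  intro 𝓕
  have : Fact p.Prime := ⟨hp⟩
  have hf (k : ℕ) : (X ^ (2 * 3 ^ k) + X ^ 3 ^ k + 1 : (ZMod p)[X]) ∈ 𝓕 := .inl (.inl ⟨k, rfl⟩)
  have hg (k : ℕ) : (X ^ (2 * 3 ^ k) - X ^ 3 ^ k + 1 : (ZMod p)[X]) ∈ 𝓕 := .inl (.inr ⟨k, rfl⟩)
  have hsub : (X - 1 : (ZMod p)[X]) ∈ 𝓕 := .inr (by simp)
  have hX : (X : (ZMod p)[X]) ∈ 𝓕 := .inr (by simp)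
  have hadd : (X + 1 : (ZMod p)[X]) ∈ 𝓕 := .inr (by simp)
  have hmi : ∀ P ∈ 𝓕, P.Monic ∧ Irreducible P := by
    rintro P ((⟨k, rfl⟩ | ⟨k, rfl⟩) | rfl | rfl | rfl)
    · rw [← cyclotomic_three_pow_succ]
      exact ⟨cyclotomic.monic _ _, ZMod.irreducible_cyclotomic_three_pow_succ hmod k⟩
    · constructor
      · rw [sub_add]
        refine monic_X_pow_sub ((degree_sub_le _ _).trans_lt ?_)
        simp
      · rw [← comp_neg_X_trinomial, ← cyclotomic_three_pow_succ]
        exact (ZMod.irreducible_cyclotomic_three_pow_succ hmod k).comp_neg_X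
    · exact ⟨monic_X_sub_C 1, irreducible_X_sub_C 1⟩
    · exact ⟨monic_X, irreducible_X⟩
    · exact ⟨monic_X_add_C 1, by simpa using irreducible_X_sub_C (-1 : ZMod p)⟩
  refine ⟨hmi, fun P hP Q hQm hQ hdvd ↦ ?_⟩
  have hmem {F : (ZMod p)[X]} (hF : F ∈ 𝓕) (h : Q ∣ F) : Q ∈ 𝓕 := by
    obtain ⟨hFm, hFi⟩ := hmi F hF
    rwa [eq_of_monic_of_associated hQm hFm (hQ.associated_of_dvd hFi h)]
  rcases hP with (⟨k, rfl⟩ | ⟨k, rfl⟩) | rfl | rfl | rfl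
  · have h : (X ^ (2 * 3 ^ k) + X ^ 3 ^ k + 1 : (ZMod p)[X]) - C 1 =
        X ^ 3 ^ k * (X ^ 3 ^ k + 1) := by rw [C_1]; ring
    rw [show coeff _ 0 = (1 : ZMod p) by simp [coeff_X_pow, (pow_ne_zero k three_ne_zero).symm], h, X_pow_three_pow_add_one] at hdvd
    rcases hQ.prime.dvd_or_dvd hdvd with h | h
    · exact hmem hX (hQ.prime.dvd_of_dvd_pow h)
    rcases hQ.prime.dvd_or_dvd h with h | h
    · exact hmem hadd h
    obtain ⟨i, -, h⟩ := hQ.prime.exists_mem_finset_dvd h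
    exact hmem (hg i) h
  · have h : (X ^ (2 * 3 ^ k) - X ^ 3 ^ k + 1 : (ZMod p)[X]) - C 1 =
        X ^ 3 ^ k * (X ^ 3 ^ k - 1) := by rw [C_1]; ring
    rw [show coeff _ 0 = (1 : ZMod p) by simp [coeff_X_pow, (pow_ne_zero k three_ne_zero).symm], h, X_pow_three_pow_sub_one] at hdvd
    rcases hQ.prime.dvd_or_dvd hdvd with h | h
    · exact hmem hX (hQ.prime.dvd_of_dvd_pow h)
    rcases hQ.prime.dvd_or_dvd h with h | h
    · exact hmem hsub h
    obtain ⟨i, -, h⟩ := hQ.prime.exists_mem_finset_dvd h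
    exact hmem (hf i) h
  all_goals exact hmem hX (by simpa using hdvd)
end
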